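/- arXiv:0706.1738 — 2 statements merged into one kernel-verified Lean document; each statement's English description precedes it below -/
import Mathlib

section
/- Let a_1, …, a_k be positive integers and, for a sequence (b_1,…,b_k) of positive integers with partial sums s_i = b_1 + ⋯ + b_i and ℓ = s_k, let M(b_1,…,b_k) be the number of derangements π of [ℓ] such that π(j) > π(j+1) for every j ∈ [ℓ−1] ∖ {s_1,…,s_{k−1}}. Then M is a symmetric function of its arguments: for every permutation τ of [k], M(a_1, a_2, …, a_k) = M(a_{τ(1)}, a_{τ(2)}, …, a_{τ(k)}). -/
/-- The value of a permutation of `[n] = {1, …, n}` at `i`, in 1-based terms: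
for `1 ≤ i ≤ n` this is `σ(i) ∈ {1, …, n}`; outside `[n]` we return `i`. -/
def permToFun {n : ℕ} (σ : Equiv.Perm (Fin n)) (i : ℕ) : ℕ :=
  if h : 1 ≤ i ∧ i ≤ n then ((σ ⟨i - 1, by omega⟩ : Fin n) : ℕ) + 1 else i

/-- `fix σ`: the number of fixed points of a permutation of `[n]`. -/
def fixCount {n : ℕ} (σ : Equiv.Perm (Fin n)) : ℕ :=
  ((Finset.Icc 1 n).filter fun i => permToFun σ i = i).card

/-- `exc σ`: the number of excedances of a permutation of `[n]`. -/
def excCount {n : ℕ} (σ : Equiv.Perm (Fin n)) : ℕ :=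
  ((Finset.Icc 1 n).filter fun i => i < permToFun σ i).card

/-- `DES σ`: the descent set of a permutation of `[n]`, a subset of `[n-1]`. -/
def desSet {n : ℕ} (σ : Equiv.Perm (Fin n)) : Finset ℕ :=
  (Finset.Icc 1 (n - 1)).filter fun i => permToFun σ (i + 1) < permToFun σ i

/-- `M(b₁,…,b_k)`: the number of derangements `π` of `[ℓ]`, `ℓ = b₁ + ⋯ + b_k`, such
that `π(j) > π(j+1)` for every `j ∈ [ℓ-1]` which is not one of the partial sums
`s₁, …, s_{k-1}` (where `sᵢ = b₁ + ⋯ + bᵢ`). -/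
noncomputable def Mnum (k : ℕ) (b : Fin k → ℕ) : ℕ :=
  Nat.card {π : Equiv.Perm (Fin (∑ i, b i)) //
    fixCount π = 0 ∧
    ∀ j ∈ Finset.Icc 1 (∑ i, b i - 1),
      (¬ ∃ i : Fin k, (i : ℕ) < k - 1 ∧
          j = ∑ l ∈ Finset.univ.filter (fun l => l ≤ i), b l) →
        permToFun π (j + 1) < permToFun π j}

open Finset

section Words

variable {α : Type*} [LinearOrder α]

/-- The number of letters of `l` that are at least `i`. -/
def countGE (i : α) (l : List α) : ℕ := l.countP fun x => decide (i ≤ x)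

/-- The number of letters of `l` that are at most `i`. -/
def countLE (i : α) (l : List α) : ℕ := l.countP fun x => decide (x ≤ i)

/-- The word `l` has a letter `i` such that the letters `≥ i` to its left are as many as the
letters `≤ i` to its right. For the word of a permutation decreasing on blocks, this says that the
permutation has a fixed point in block `i`. -/
def HasFix (i : α) (l : List α) : Prop :=
  ∃ u z, l = u ++ i :: z ∧ countGE i u = countLE i z

@[simp] lemma countGE_nil (i : α) : countGE i [] = 0 := rfl

@[simp] lemma countLE_nil (i : α) : countLE i [] = 0 := rfl

@[simp] lemma countGE_append (i : α) (u v : List α) :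
    countGE i (u ++ v) = countGE i u + countGE i v := List.countP_append

@[simp] lemma countLE_append (i : α) (u v : List α) :
    countLE i (u ++ v) = countLE i u + countLE i v := List.countP_append

@[simp] lemma countGE_cons (i x : α) (l : List α) :
    countGE i (x :: l) = countGE i l + if i ≤ x then 1 else 0 := by
  simp [countGE, List.countP_cons]

@[simp] lemma countLE_cons (i x : α) (l : List α) :
    countLE i (x :: l) = countLE i l + if x ≤ i then 1 else 0 := by
  simp [countLE, List.countP_cons]

lemma countGE_anti {i j : α} (h : i ≤ j) (l : List α) : countGE j l ≤ countGE i l :=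
  List.countP_mono_left fun x _ hx => by
    simp only [decide_eq_true_eq] at hx ⊢
    exact h.trans hx

lemma countLE_mono {i j : α} (h : i ≤ j) (l : List α) : countLE i l ≤ countLE j l :=
  List.countP_mono_left fun x _ hx => by
    simp only [decide_eq_true_eq] at hx ⊢
    exact hx.trans h

lemma eq_nil_of_countGE_countLE {i : α} {l : List α} (h : countGE i l + countLE i l = 0) :
    l = [] := by
  cases l with
  | nil => rfl
  | cons x l =>
    rcases le_total i x with hx | hx <;> simp [hx] at h

lemma hasFix_or_exists_split_of_le (i : α) (z u : List α) (h : countGE i u ≤ countLE i z) :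
    HasFix i (u ++ z) ∨ ∃ u' z', u ++ z = u' ++ z' ∧ countGE i u' = countLE i z' := by
  induction z generalizing u with
  | nil => exact Or.inr ⟨u, [], rfl, by simpa using h⟩
  | cons x z ih =>
    by_cases h₁ : countGE i u = countLE i (x :: z)
    · exact Or.inr ⟨u, x :: z, rfl, h₁⟩
    by_cases h₂ : x = i ∧ countGE i u = countLE i z
    · obtain ⟨rfl, h₂⟩ := h₂
      exact Or.inl ⟨u, z, rfl, h₂⟩
    have := ih (u ++ [x]) (by
      rcases lt_trichotomy x i with hx | hx | hx
      · simp [hx.le, hx.not_ge] at h h₁ ⊢; omega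
      · simp [hx] at h h₁ h₂ ⊢; omega
      · simp [hx.le, hx.not_ge] at h h₁ ⊢; omega)
    simpa using this

lemma hasFix_or_exists_split (i : α) (l : List α) :
    HasFix i l ∨ ∃ u z, l = u ++ z ∧ countGE i u = countLE i z :=
  hasFix_or_exists_split_of_le i l [] (by simp)

lemma not_hasFix_of_balanced {i : α} {u z : List α} (h : countGE i u = countLE i z) :
    ¬ HasFix i (u ++ z) := by
  rintro ⟨u', z', he, h'⟩
  rcases List.append_eq_append_iff.1 he with ⟨a, rfl, rfl⟩ | ⟨a, rfl, ha⟩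
  · simp at h h'; omega
  · rcases a with _ | ⟨x, a⟩
    · simp only [List.nil_append] at ha
      subst ha
      simp at h h'; omega
    · simp only [List.cons_append, List.cons.injEq] at ha
      obtain ⟨rfl, rfl⟩ := ha
      simp at h h'; omega

lemma split_unique {i : α} {u z u' z' : List α} (h : countGE i u = countLE i z)
    (h' : countGE i u' = countLE i z') (he : u ++ z = u' ++ z') : u = u' ∧ z = z' := by
  rcases List.append_eq_append_iff.1 he with ⟨a, rfl, rfl⟩ | ⟨a, rfl, rfl⟩
  all_goals
    have : a = [] := eq_nil_of_countGE_countLE (i := i) (by simp at h h'; omega)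
    simp [this]

lemma split_cons_unique {i : α} {u z u' z' : List α} (h : countGE i u = countLE i z)
    (h' : countGE i u' = countLE i z') (he : u ++ i :: z = u' ++ i :: z') : u = u' ∧ z = z' := by
  rcases List.append_eq_append_iff.1 he with ⟨a, rfl, ha⟩ | ⟨a, rfl, ha⟩
  all_goals
    rcases a with _ | ⟨x, a⟩
    · simpa [eq_comm] using ha
    · simp only [List.cons_append, List.cons.injEq] at ha
      obtain ⟨rfl, rfl⟩ := ha
      simp at h h'; omega

lemma hasFix_insert_iff {i j : α} (hij : j ≠ i) {u z : List α} (h : countGE i u = countLE i z) :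
    HasFix j (u ++ i :: z) ↔ HasFix j (u ++ z) := by
  constructor
  · rintro ⟨u', z', he, h'⟩
    rcases List.append_eq_append_iff.1 he with ⟨a, rfl, ha⟩ | ⟨a, rfl, ha⟩
    · rcases a with _ | ⟨x, a⟩
      · simp [hij.symm] at ha
      simp only [List.cons_append, List.cons.injEq] at ha
      obtain ⟨rfl, rfl⟩ := ha
      rcases lt_or_gt_of_ne hij with hlt | hlt
      · have h₁ := countGE_anti hlt.le u
        have h₂ := countLE_mono hlt.le z'
        simp [hlt.le] at h h'; omega
      · exact ⟨u ++ a, z', by simp, by simpa [hlt.not_ge] using h'⟩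
    · rcases a with _ | ⟨x, a⟩
      · simp [hij] at ha
      simp only [List.cons_append, List.cons.injEq] at ha
      obtain ⟨rfl, rfl⟩ := ha
      rcases lt_or_gt_of_ne hij with hlt | hlt
      · exact ⟨u', a ++ z, by simp, by simpa [hlt.not_ge] using h'⟩
      · have h₁ := countGE_anti hlt.le u'
        have h₂ := countLE_mono hlt.le z
        simp [hlt.le] at h h'; omega
  · rintro ⟨u', z', he, h'⟩
    by_cases hz : ∃ a, u' = u ++ a ∧ z = a ++ j :: z'
    · obtain ⟨a, rfl, rfl⟩ := hz
      rcases lt_or_gt_of_ne hij with hlt | hlt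
      · have h₁ := countGE_anti hlt.le u
        have h₂ := countLE_mono hlt.le z'
        simp [hlt.le] at h h'; omega
      · exact ⟨u ++ i :: a, z', by simp, by simpa [hlt.not_ge] using h'⟩
    · rcases List.append_eq_append_iff.1 he with ⟨a, ha⟩ | ⟨a, rfl, ha⟩
      · exact absurd ⟨a, ha⟩ hz
      rcases a with _ | ⟨x, a⟩
      · exact absurd ⟨[], by simpa using ha.symm⟩ hz
      simp only [List.cons_append, List.cons.injEq] at ha
      obtain ⟨rfl, rfl⟩ := ha
      rcases lt_or_gt_of_ne hij with hlt | hlt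
      · exact ⟨u', a ++ i :: z, by simp, by simpa [hlt.not_ge] using h'⟩
      · have h₁ := countGE_anti hlt.le u'
        have h₂ := countLE_mono hlt.le z
        simp [hlt.le] at h h'
        omega

/-- The words with letters `m` that have no fixed point in the blocks of `S`. -/
def fixFreeWords (S : Finset α) (m : Multiset α) : Set (List α) :=
  {l | (l : Multiset α) = m ∧ ∀ i ∈ S, ¬ HasFix i l}

lemma finite_fixFreeWords (S : Finset α) (m : Multiset α) : (fixFreeWords S m).Finite := by
  induction m using Quotient.inductionOn with
  | h l₀ =>
    refine (List.finite_toSet l₀.permutations).subset ?_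
    rintro l ⟨hl, -⟩
    exact List.mem_permutations.2 (Multiset.coe_eq_coe.1 hl)

lemma fixFreeWords_insert_of_notMem {S : Finset α} {m : Multiset α} {i : α} (hi : i ∉ m) :
    fixFreeWords (insert i S) m = fixFreeWords S m := by
  ext l
  simp only [fixFreeWords, Set.mem_ofPred_eq, Finset.forall_mem_insert]
  refine and_congr_right fun hl => and_iff_right ?_
  rintro ⟨u, z, rfl, -⟩
  exact hi (by simp [← hl])

lemma ncard_fixFreeWords_cons {S : Finset α} {i : α} (hi : i ∉ S) (m : Multiset α) :
    (fixFreeWords S (i ::ₘ m)).ncard =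
      (fixFreeWords (insert i S) m).ncard + (fixFreeWords (insert i S) (i ::ₘ m)).ncard := by
  let T : Set (List α × List α) :=
    {p | countGE i p.1 = countLE i p.2 ∧ p.1 ++ p.2 ∈ fixFreeWords S m}
  have h₁ : (fixFreeWords (insert i S) m).ncard = T.ncard := by
    rw [← Set.InjOn.ncard_image (f := fun p : List α × List α => p.1 ++ p.2) (s := T)]
    · congr 1
      ext l
      simp only [fixFreeWords, Finset.forall_mem_insert, Set.mem_image, Set.mem_ofPred_eq, T]
      constructor
      · rintro ⟨hl, hn, hS⟩
        obtain ⟨u, z, rfl, h⟩ := (hasFix_or_exists_split i l).resolve_left hn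
        exact ⟨(u, z), ⟨h, hl, hS⟩, rfl⟩
      · rintro ⟨⟨u, z⟩, ⟨h, hl, hS⟩, rfl⟩
        exact ⟨hl, not_hasFix_of_balanced h, hS⟩
    · rintro ⟨u, z⟩ ⟨h, -⟩ ⟨u', z'⟩ ⟨h', -⟩ he
      exact Prod.ext_iff.2 (split_unique h h' he)
  have h₂ : (fixFreeWords S (i ::ₘ m) ∩ {l | HasFix i l}).ncard = T.ncard := by
    rw [← Set.InjOn.ncard_image (f := fun p : List α × List α => p.1 ++ i :: p.2) (s := T)]
    · congr 1
      have key : ∀ u z : List α, countGE i u = countLE i z →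
          (u ++ i :: z ∈ fixFreeWords S (i ::ₘ m) ↔ u ++ z ∈ fixFreeWords S m) := by
        intro u z h
        refine and_congr ?_ (forall₂_congr fun j hj => not_congr
          (hasFix_insert_iff (ne_of_mem_of_not_mem hj hi) h))
        rw [← Multiset.cons_inj_right i (s := ((u ++ z : List α) : Multiset α)), Multiset.cons_coe,
          Multiset.coe_eq_coe.2 (List.perm_middle (a := i) (l₁ := u) (l₂ := z))]
      ext l
      constructor
      · rintro ⟨hl, u, z, rfl, h⟩
        exact ⟨(u, z), ⟨h, (key u z h).1 hl⟩, rfl⟩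
      · rintro ⟨⟨u, z⟩, ⟨h, hl⟩, rfl⟩
        exact ⟨(key u z h).2 hl, u, z, rfl, h⟩
    · rintro ⟨u, z⟩ ⟨h, -⟩ ⟨u', z'⟩ ⟨h', -⟩ he
      exact Prod.ext_iff.2 (split_cons_unique h h' he)
  have h₃ : fixFreeWords S (i ::ₘ m) \ {l | HasFix i l} = fixFreeWords (insert i S) (i ::ₘ m) := by
    ext l
    simp only [fixFreeWords, Finset.forall_mem_insert, Set.mem_sdiff, Set.mem_ofPred_eq]
    tauto
  rw [h₁, ← h₂, ← h₃, Set.ncard_inter_add_ncard_sdiff_eq_ncard _ _ (finite_fixFreeWords _ _)]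

/-- The number of words avoiding fixed points in the blocks of `S` is invariant under renaming
the letters. -/
lemma ncard_fixFreeWords_map (τ : Equiv.Perm α) (S : Finset α) (m : Multiset α) :
    (fixFreeWords (S.map τ.toEmbedding) (m.map τ)).ncard = (fixFreeWords S m).ncard := by
  induction S using Finset.induction_on generalizing m with
  | empty =>
    rw [← Set.ncard_image_of_injective (fixFreeWords ∅ m) (List.map_injective_iff.2 τ.injective)]
    congr 1
    ext l
    simp only [fixFreeWords, Finset.map_empty, Finset.notMem_empty, false_imp_iff, implies_true,
      and_true, Set.mem_ofPred_eq, Set.mem_image]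
    constructor
    · intro hl
      refine ⟨l.map τ.symm, ?_, by simp⟩
      rw [← Multiset.map_coe, hl]
      simp
    · rintro ⟨l, rfl, rfl⟩
      simp
  | insert i S hi ih =>
    have hi' : τ i ∉ S.map τ.toEmbedding := by simpa using hi
    have hins : (insert i S).map τ.toEmbedding = insert (τ i) (S.map τ.toEmbedding) := by
      simp [Finset.map_insert]
    rw [hins]
    induction m using Multiset.strongInductionOn with
    | ih m ihm =>
      by_cases him : i ∈ m
      · obtain ⟨m, rfl⟩ := Multiset.exists_cons_of_mem him
        have e₁ := ncard_fixFreeWords_cons hi m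
        have e₂ := ncard_fixFreeWords_cons hi' (m.map τ)
        have e₃ := ih (i ::ₘ m)
        have e₄ := ihm m (Multiset.lt_cons_self m i)
        rw [Multiset.map_cons] at e₃ ⊢
        omega
      · rw [fixFreeWords_insert_of_notMem him, fixFreeWords_insert_of_notMem (by simpa using him),
          ih]

end Words

section Ranks

variable {α : Type*} {n : ℕ}

lemma countP_take_ofFn (p : α → Bool) (w : Fin n → α) (m : ℕ) :
    ((List.ofFn w).take m).countP p = #{v : Fin n | (v : ℕ) < m ∧ p (w v)} := by
  induction n generalizing m with
  | zero => simp
  | succ n ih =>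
    cases m with
    | zero => simp
    | succ m =>
      rw [List.ofFn_succ, List.take_succ_cons, List.countP_cons, ih, Fin.card_filter_univ_succ']
      simp [add_comm]

lemma countP_drop_ofFn (p : α → Bool) (w : Fin n → α) (m : ℕ) :
    ((List.ofFn w).drop m).countP p = #{v : Fin n | m ≤ (v : ℕ) ∧ p (w v)} := by
  induction n generalizing m with
  | zero => simp
  | succ n ih =>
    cases m with
    | zero =>
      have := ih (fun i => w i.succ) 0
      rw [List.drop_zero] at this
      rw [List.drop_zero, List.ofFn_succ, List.countP_cons, this, Fin.card_filter_univ_succ']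
      simp [add_comm]
    | succ m =>
      rw [List.ofFn_succ, List.drop_succ_cons, ih, Fin.card_filter_univ_succ']
      simp

variable [LinearOrder α]

/-- The rank of `v` when `Fin n` is sorted by increasing `w`, ties being broken by decreasing
index. -/
def lexRank (w : Fin n → α) (v : Fin n) : ℕ := #{x | w x < w v ∨ w x = w v ∧ v < x}

lemma lexRank_eq_iff (w : Fin n → α) (v : Fin n) :
    lexRank w v = v ↔ countGE (w v) ((List.ofFn w).take v) =
      countLE (w v) ((List.ofFn w).drop (v + 1)) := by
  have h₁ : lexRank w v =
      #{x : Fin n | x < v ∧ w x < w v} + #{x : Fin n | v < x ∧ w x ≤ w v} := by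
    rw [lexRank, ← card_union_of_disjoint, ← filter_or]
    · congr 1
      ext x
      simp only [mem_filter, mem_univ, true_and]
      constructor
      · rintro (h | ⟨h, h'⟩)
        · rcases lt_trichotomy x v with hx | rfl | hx
          · exact Or.inl ⟨hx, h⟩
          · exact absurd h (lt_irrefl _)
          · exact Or.inr ⟨hx, h.le⟩
        · exact Or.inr ⟨h', h.le⟩
      · rintro (h | ⟨h, h'⟩)
        · exact Or.inl h.2
        · exact h'.lt_or_eq.imp id fun e => ⟨e, h⟩
    · rw [disjoint_filter]
      exact fun x _ h h' => lt_asymm h.1 h'.1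
  have h₂ : (v : ℕ) =
      #{x : Fin n | x < v ∧ w x < w v} + #{x : Fin n | x < v ∧ w v ≤ w x} := by
    rw [← card_union_of_disjoint, ← filter_or]
    · conv_lhs => rw [← Fin.card_Iio v]
      congr 1
      ext x
      simp only [mem_filter, mem_univ, true_and, mem_Iio, ← and_or_left, lt_or_ge, and_true]
    · rw [disjoint_filter]
      exact fun x _ h h' => h.2.not_ge h'.2
  rw [countGE, countLE, countP_take_ofFn, countP_drop_ofFn]
  simp only [decide_eq_true_eq, Fin.val_fin_lt, Nat.succ_le_iff]
  omega

lemma hasFix_ofFn_iff (i : α) (w : Fin n → α) :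
    HasFix i (List.ofFn w) ↔ ∃ v, w v = i ∧ lexRank w v = v := by
  constructor
  · rintro ⟨u, z, he, h⟩
    have hlen : u.length < n := by
      have := congrArg List.length he
      simp at this
      omega
    have hi : w ⟨u.length, hlen⟩ = i := by
      have : (List.ofFn w)[u.length]? = some i := by simp [he]
      simpa [hlen] using this
    refine ⟨⟨u.length, hlen⟩, hi, ?_⟩
    rw [lexRank_eq_iff, hi, he]
    simpa [List.drop_append, List.drop_eq_nil_of_le] using h
  · rintro ⟨v, rfl, h⟩
    refine ⟨_, _, ?_, (lexRank_eq_iff w v).1 h⟩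
    conv_lhs => rw [← List.take_append_drop v (List.ofFn w)]
    rw [List.drop_eq_getElem_cons (by simp)]
    simp

lemma lexRank_lt_of_lex (w : Fin n → α) {u v : Fin n} (h : w u < w v ∨ w u = w v ∧ v < u) :
    lexRank w u < lexRank w v := by
  refine card_lt_card (ssubset_iff_of_subset ?_ |>.2 ⟨u, by simpa using h, by simp⟩)
  intro x hx
  simp only [mem_filter, mem_univ, true_and] at hx ⊢
  rcases h with h | ⟨h, huv⟩
  · rcases hx with hx | ⟨hx, -⟩
    · exact Or.inl (hx.trans h)
    · exact Or.inl (hx ▸ h)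
  · rw [h] at hx
    exact hx.imp id fun hx => ⟨hx.1, huv.trans hx.2⟩

lemma lexRank_lt_iff (w : Fin n → α) (u v : Fin n) :
    lexRank w u < lexRank w v ↔ w u < w v ∨ w u = w v ∧ v < u := by
  refine ⟨fun h => ?_, lexRank_lt_of_lex w⟩
  by_contra hn
  rcases eq_or_ne u v with rfl | huv
  · exact lt_irrefl _ h
  refine lt_asymm h (lexRank_lt_of_lex w ?_)
  rcases lt_trichotomy (w u) (w v) with hw | hw | hw
  · exact absurd (Or.inl hw) hn
  · exact Or.inr ⟨hw.symm, (not_lt.1 fun hh => hn (Or.inr ⟨hw, hh⟩)).lt_of_ne huv⟩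
  · exact Or.inl hw

lemma lexRank_lt (w : Fin n → α) (v : Fin n) : lexRank w v < n := by
  refine (card_lt_card (?_ : _ ⊂ (univ : Finset (Fin n)))).trans_eq (by simp)
  rw [ssubset_univ_iff]
  intro h
  simpa using h.ge (mem_univ v)

lemma lexRank_injective (w : Fin n → α) : Function.Injective (lexRank w) := by
  intro u v h
  by_contra huv
  have h₁ := (lexRank_lt_iff w u v).not.1 h.not_lt
  have h₂ := (lexRank_lt_iff w v u).not.1 h.not_gt
  push Not at h₁ h₂
  exact huv (le_antisymm (h₁.2 (le_antisymm h₂.1 h₁.1)) (h₂.2 (le_antisymm h₁.1 h₂.1)))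

/-- The permutation of `Fin n` given by `lexRank w`. -/
noncomputable def lexPerm (w : Fin n → α) : Equiv.Perm (Fin n) :=
  Equiv.ofBijective (fun v => ⟨lexRank w v, lexRank_lt w v⟩)
    (Finite.injective_iff_bijective.1 fun _ _ h => lexRank_injective w (Fin.ext_iff.1 h))

lemma lexPerm_lt_iff (w : Fin n → α) (u v : Fin n) :
    lexPerm w u < lexPerm w v ↔ w u < w v ∨ w u = w v ∧ v < u := lexRank_lt_iff w u v

lemma lexPerm_comp_symm {c : Fin n → α} (hc : Monotone c) {π : Equiv.Perm (Fin n)}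
    (hπ : ∀ x y, x < y → c x = c y → π y < π x) : lexPerm (c ∘ π.symm) = π.symm := by
  ext v
  change lexRank (c ∘ π.symm) v = _
  rw [lexRank, ← Fin.card_Iio (π.symm v)]
  refine card_bij (fun x _ => π.symm x) ?_ (fun _ _ _ _ h => π.symm.injective h) ?_
  · intro x hx
    simp only [mem_filter, mem_univ, true_and, Function.comp_apply, mem_Iio] at hx ⊢
    rcases hx with hx | ⟨hx, hvx⟩
    · exact hc.reflect_lt hx
    · by_contra hle
      rcases (not_lt.1 hle).eq_or_lt with h | h
      · exact hvx.ne (π.symm.injective h)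
      · have := hπ _ _ h hx.symm
        simp only [Equiv.apply_symm_apply] at this
        exact lt_asymm this hvx
  · intro y hy
    refine ⟨π y, ?_, by simp⟩
    simp only [mem_filter, mem_univ, true_and, Function.comp_apply, mem_Iio,
      Equiv.symm_apply_apply] at hy ⊢
    refine (hc hy.le).lt_or_eq.imp id fun h => ⟨h, ?_⟩
    simpa using hπ _ _ hy h

lemma comp_lexPerm {c w : Fin n → α} (hc : Monotone c)
    (hw : (univ.val.map w : Multiset α) = univ.val.map c) : c ∘ lexPerm w = w := by
  have hmono : Monotone (w ∘ (lexPerm w).symm) := by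
    intro x y hxy
    rcases hxy.eq_or_lt with rfl | hlt
    · rfl
    rw [← (lexPerm w).apply_symm_apply x, ← (lexPerm w).apply_symm_apply y,
      lexPerm_lt_iff] at hlt
    exact hlt.elim le_of_lt fun h => h.1.le
  have hperm : (List.ofFn (w ∘ (lexPerm w).symm)).Perm (List.ofFn c) := by
    refine Multiset.coe_eq_coe.1 ?_
    rw [← Fin.univ_val_map, ← Fin.univ_val_map, ← hw, ← Multiset.map_map]
    congr 1
    exact congrArg Finset.val (map_univ_equiv (lexPerm w).symm)
  have := List.ofFn_injective (hperm.eq_of_sortedLE hmono.sortedLE_ofFn hc.sortedLE_ofFn)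
  rw [← this]
  ext v
  simp

lemma ncard_derangements_decreasing [Fintype α] {c : Fin n → α} (hc : Monotone c) :
    {π : Equiv.Perm (Fin n) | (∀ v, π v ≠ v) ∧ ∀ x y, x < y → c x = c y → π y < π x}.ncard =
      (fixFreeWords univ (univ.val.map c)).ncard := by
  rw [← Set.InjOn.ncard_image (f := fun π : Equiv.Perm (Fin n) => List.ofFn (c ∘ π.symm))]
  · congr 1
    ext l
    constructor
    · rintro ⟨π, ⟨hfix, hπ⟩, rfl⟩
      refine ⟨?_, fun i _ => ?_⟩
      · rw [← Fin.univ_val_map, ← Multiset.map_map]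
        congr 1
        exact congrArg Finset.val (map_univ_equiv π.symm)
      · rw [hasFix_ofFn_iff]
        rintro ⟨v, -, hv⟩
        have h : lexPerm (c ∘ π.symm) v = v := Fin.ext hv
        rw [lexPerm_comp_symm hc hπ, Equiv.symm_apply_eq] at h
        exact hfix v h.symm
    · rintro ⟨hl, hfix⟩
      have hlen : l.length = n := by simpa using congrArg Multiset.card hl
      obtain ⟨w, rfl⟩ : ∃ w : Fin n → α, List.ofFn w = l := by
        subst hlen
        exact ⟨l.get, List.ofFn_get l⟩
      rw [← Fin.univ_val_map] at hl
      have hcw := comp_lexPerm hc hl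
      refine ⟨(lexPerm w).symm, ⟨fun v hv => ?_, fun x y hxy h => ?_⟩, by simp [hcw]⟩
      · refine hfix (w v) (mem_univ _) ((hasFix_ofFn_iff _ _).2 ⟨v, rfl, ?_⟩)
        exact congrArg Fin.val ((Equiv.symm_apply_eq _).1 hv).symm
      · obtain ⟨u, rfl⟩ := (lexPerm w).surjective x
        obtain ⟨v, rfl⟩ := (lexPerm w).surjective y
        have hu : c (lexPerm w u) = w u := congrFun hcw u
        have hv : c (lexPerm w v) = w v := congrFun hcw v
        rw [hu, hv] at h
        simpa [lexPerm_lt_iff, h] using hxy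
  · rintro π ⟨-, hπ⟩ π' ⟨-, hπ'⟩ h
    have h' := List.ofFn_injective h
    have := lexPerm_comp_symm hc hπ
    rw [h', lexPerm_comp_symm hc hπ'] at this
    exact (Equiv.symm_bijective.injective this).symm

end Ranks

section Blocks

variable {k : ℕ}

/-- The index of the block containing a position, for consecutive blocks of sizes `b`. -/
def blockIndex (b : Fin k → ℕ) (x : Fin (∑ i, b i)) : Fin k := (finSigmaFinEquiv.symm x).1

lemma blockIndex_le_iff (b : Fin k → ℕ) (x : Fin (∑ i, b i)) (i : Fin k) :
    blockIndex b x ≤ i ↔ (x : ℕ) < ∑ l with l ≤ i, b l := by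
  obtain ⟨⟨j, t⟩, rfl⟩ := finSigmaFinEquiv.surjective x
  have hsum : ∑ l : Fin j, b (Fin.castLE j.2.le l) = ∑ l with l < j, b l := by
    refine sum_bij (fun l _ => Fin.castLE j.2.le l) (fun l _ => ?_) (fun _ _ _ _ h => ?_)
      (fun l hl => ?_) (fun _ _ => rfl)
    · exact mem_filter.2 ⟨mem_univ _, l.2⟩
    · exact Fin.castLE_injective _ h
    · exact ⟨⟨l, (mem_filter.1 hl).2⟩, mem_univ _, rfl⟩
  rw [blockIndex, Equiv.symm_apply_apply, finSigmaFinEquiv_apply, hsum]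
  dsimp only
  constructor
  · intro h
    have h₁ : ∑ l with l ≤ j, b l = ∑ l with l < j, b l + b j := by
      rw [add_comm, ← sum_insert (by simp)]
      congr 1
      ext l
      simp [le_iff_eq_or_lt]
    have h₂ : ∑ l with l ≤ j, b l ≤ ∑ l with l ≤ i, b l :=
      sum_le_sum_of_subset fun l hl => by
        simp only [mem_filter, mem_univ, true_and] at hl ⊢
        exact hl.trans h
    have := t.2
    omega
  · intro h
    by_contra hn
    have : ∑ l with l ≤ i, b l ≤ ∑ l with l < j, b l :=
      sum_le_sum_of_subset fun l hl => by
        simp only [mem_filter, mem_univ, true_and] at hl ⊢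
        exact hl.trans_lt (not_le.1 hn)
    omega

lemma blockIndex_monotone (b : Fin k → ℕ) : Monotone (blockIndex b) := fun x y hxy =>
  (blockIndex_le_iff b x _).2 (lt_of_le_of_lt hxy ((blockIndex_le_iff b y _).1 le_rfl))

lemma exists_partialSum_iff (b : Fin k → ℕ) {x y : Fin (∑ i, b i)} (hxy : (y : ℕ) = x + 1) :
    (∃ i : Fin k, (i : ℕ) < k - 1 ∧ (y : ℕ) = ∑ l with l ≤ i, b l) ↔
      blockIndex b x ≠ blockIndex b y := by
  constructor
  · rintro ⟨i, -, hi⟩ h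
    have h₁ := (blockIndex_le_iff b x i).2 (by omega)
    rw [h, blockIndex_le_iff] at h₁
    omega
  · intro h
    have hlt := (blockIndex_monotone b (Fin.le_def.2 (by omega) : x ≤ y)).lt_of_ne h
    refine ⟨blockIndex b x, ?_, ?_⟩
    · have := (blockIndex b y).2
      rw [Fin.lt_def] at hlt
      omega
    · have h₁ := (blockIndex_le_iff b x _).1 le_rfl
      have h₂ := (blockIndex_le_iff b y _).not.1 hlt.not_ge
      omega

lemma forall_lt_iff_forall_succ {n : ℕ} {α : Type*} [LinearOrder α] {c : Fin n → α}
    (hc : Monotone c) (π : Fin n → Fin n) :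
    (∀ x y, x < y → c x = c y → π y < π x) ↔
      ∀ x y : Fin n, (y : ℕ) = x + 1 → c x = c y → π y < π x := by
  refine ⟨fun h x y hxy => h x y (Fin.lt_def.2 (by omega)), fun h => ?_⟩
  suffices H : ∀ (d : ℕ) (x y : Fin n), (y : ℕ) = x + 1 + d → c x = c y → π y < π x from
    fun x y hxy => H (y - x - 1) x y (by rw [Fin.lt_def] at hxy; omega)
  intro d
  induction d with
  | zero => exact h
  | succ d ih =>
    intro x y hxy hcxy
    have hz : (x : ℕ) + 1 + d < n := by omega
    have h₁ : c x ≤ c ⟨x + 1 + d, hz⟩ := hc (Fin.le_def.2 (by dsimp only; omega))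
    have h₂ : c ⟨x + 1 + d, hz⟩ ≤ c y := hc (Fin.le_def.2 (by dsimp only; omega))
    exact (h ⟨x + 1 + d, hz⟩ y (by dsimp only; omega) (le_antisymm h₂ (hcxy ▸ h₁))).trans
      (ih x ⟨x + 1 + d, hz⟩ rfl (le_antisymm h₁ (hcxy ▸ h₂)))

lemma permToFun_val_add_one {n : ℕ} (σ : Equiv.Perm (Fin n)) (x : Fin n) :
    permToFun σ (x + 1) = σ x + 1 := by
  rw [permToFun, dif_pos ⟨by omega, x.2⟩]
  rfl

lemma fixCount_eq_zero_iff {n : ℕ} (σ : Equiv.Perm (Fin n)) :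
    fixCount σ = 0 ↔ ∀ v, σ v ≠ v := by
  rw [fixCount, card_eq_zero, filter_eq_empty_iff]
  constructor
  · intro h v hv
    refine h (x := (v : ℕ) + 1) (mem_Icc.2 ⟨by omega, v.2⟩) ?_
    rw [permToFun_val_add_one, hv]
  · intro h i hi hv
    rw [mem_Icc] at hi
    obtain ⟨v, rfl⟩ : ∃ v : Fin n, i = v + 1 := ⟨⟨i - 1, by omega⟩, by dsimp only; omega⟩
    rw [permToFun_val_add_one] at hv
    exact h v (Fin.ext (by omega))

lemma Mnum_eq (b : Fin k → ℕ) :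
    Mnum k b = (fixFreeWords univ (univ.val.map (blockIndex b))).ncard := by
  rw [← ncard_derangements_decreasing (blockIndex_monotone b), Mnum, ← Nat.card_coe_set_eq]
  refine Nat.card_congr (Equiv.subtypeEquivRight fun π => and_congr (fixCount_eq_zero_iff π) ?_)
  rw [forall_lt_iff_forall_succ (blockIndex_monotone b)]
  constructor
  · intro h x y hxy hc
    have := h y (mem_Icc.2 ⟨by omega, by omega⟩)
      fun he => (exists_partialSum_iff b hxy).1 he hc
    rw [permToFun_val_add_one, hxy, permToFun_val_add_one] at this
    rw [Fin.lt_def]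
    omega
  · intro h j hj hn
    rw [mem_Icc] at hj
    let x : Fin (∑ i, b i) := ⟨j - 1, by omega⟩
    let y : Fin (∑ i, b i) := ⟨j, by omega⟩
    have hxy : (y : ℕ) = x + 1 := by simp only [x, y]; omega
    have := h x y hxy (not_not.1 fun hc => hn ((exists_partialSum_iff b hxy).2 hc))
    change permToFun π ((y : ℕ) + 1) < permToFun π (y : ℕ)
    rw [permToFun_val_add_one, hxy, permToFun_val_add_one]
    rw [Fin.lt_def] at this
    omega

lemma map_blockIndex (b : Fin k → ℕ) :
    (univ.val.map (blockIndex b) : Multiset (Fin k)) =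
      univ.val.map (Sigma.fst : (Σ i, Fin (b i)) → Fin k) := by
  rw [← map_univ_equiv (finSigmaFinEquiv (n := b)), map_val, Multiset.map_map]
  refine Multiset.map_congr rfl fun x _ => ?_
  simp [blockIndex]

lemma map_blockIndex_comp (b : Fin k → ℕ) (τ : Equiv.Perm (Fin k)) :
    (univ.val.map (blockIndex (b ∘ τ))).map τ = univ.val.map (blockIndex b) := by
  rw [map_blockIndex, map_blockIndex,
    ← map_univ_equiv (Equiv.sigmaCongrLeft (β := fun i => Fin (b i)) τ), map_val,
    Multiset.map_map, Multiset.map_map]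
  rfl

end Blocks

/-- `M` is a symmetric function of its arguments. -/
theorem Mnum_comp_perm (k : ℕ) (a : Fin k → ℕ) (ha : ∀ i, 0 < a i)
    (τ : Equiv.Perm (Fin k)) :
    Mnum k a = Mnum k (a ∘ τ) := by
  have h := ncard_fixFreeWords_map τ univ (univ.val.map (blockIndex (a ∘ τ)))
  rwa [map_univ_equiv, map_blockIndex_comp, ← Mnum_eq, ← Mnum_eq] at h
end

section
/- For every positive integer n there exists a bijection Ψ from the symmetric group S_n to itself such that for every permutation σ of [n]: lec Ψ(σ) = exc(σ^{−1}), pix Ψ(σ) = fix σ, and IDES Ψ(σ) = IDES σ (where lec and pix of a permutation are computed on its word σ_1σ_2…σ_n). In particular, the triples of statistics (iexc, fix, IDES) and (lec, pix, IDES) are equidistributed on S_n. -/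
/-- Split off the maximal weakly decreasing prefix of a list. -/
def decSplit : List ℕ → List ℕ × List ℕ
  | [] => ([], [])
  | [x] => ([x], [])
  | x :: y :: t =>
    if y ≤ x then
      let p := decSplit (y :: t)
      (x :: p.1, p.2)
    else ([x], y :: t)

/-- Helper computing `lec` on the *reversed* word, with fuel.  Reading the word from
the right, hooks are split off one at a time: the maximal weakly increasing suffix
together with the letter just before it forms the last hook of the
hook-factorization, and the number of inversions of a hook `a h₂ … h_r`
(with `a > h₂ ≤ h₃ ≤ ⋯ ≤ h_r`) is the number of letters `h_j < a`. -/
def lecAux : ℕ → List ℕ → ℕ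
  | 0, _ => 0
  | _, [] => 0
  | fuel + 1, r =>
    match (decSplit r).2 with
    | [] => 0
    | a :: r' => ((decSplit r).1.filter fun x => x < a).length + lecAux fuel r'

/-- `lec w`: the sum of the numbers of inversions of the hooks in the
hook-factorization of `w`. -/
def lec (w : List ℕ) : ℕ := lecAux w.length w.reverse

/-- Helper computing `pix` on the *reversed* word, with fuel. -/
def pixAux : ℕ → List ℕ → ℕ
  | 0, r => r.length
  | fuel + 1, r =>
    match (decSplit r).2 with
    | [] => (decSplit r).1.length
    | _ :: r' => pixAux fuel r'

/-- `pix w`: the length of the weakly increasing prefix in the hook-factorization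
of `w`. -/
def pix (w : List ℕ) : ℕ := pixAux w.length w.reverse

/-- A word `w` is a desarrangement if `w₁ > w₂ > ⋯ > w_{2k} ≤ w_{2k+1}` for some
`k ≥ 1`, with the convention `w_{n+1} = ∞` (indices here are 0-based via `getD`). -/
def IsDesarrangement (w : List ℕ) : Prop :=
  ∃ k : ℕ, 1 ≤ k ∧ 2 * k ≤ w.length ∧
    (∀ i : ℕ, i + 2 ≤ 2 * k → w.getD (i + 1) 0 < w.getD i 0) ∧
    (2 * k = w.length ∨ w.getD (2 * k - 1) 0 ≤ w.getD (2 * k) 0)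

/-- The word `σ₁ σ₂ … σ_n` of a permutation of `[n]` (letters in `{1, …, n}`). -/
def wordOf {n : ℕ} (σ : Equiv.Perm (Fin n)) : List ℕ :=
  List.ofFn fun i : Fin n => (σ i : ℕ) + 1

/-- The finite set of words whose multiset of letters is `c`. -/
noncomputable def rearrangements (c : Multiset ℕ) : Finset (List ℕ) :=
  c.toList.permutations.toFinset

theorem mem_rearrangements {c : Multiset ℕ} {w : List ℕ} :
    w ∈ rearrangements c ↔ (w : Multiset ℕ) = c := by
  rw [rearrangements, List.mem_toFinset, List.mem_permutations, ← Multiset.coe_eq_coe,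
    Multiset.coe_toList]

/-- A statistic `s` on words and a multiset-valued statistic `φ` satisfying a prepending rule
(the letters of `φ w` smaller than the new first letter each contribute one to `s`) and an
insertion rule (any letter can be added to `φ w`, in a unique way, without changing `s`). -/
structure IsPrependInsert (s : List ℕ → ℕ) (φ : List ℕ → Multiset ℕ) : Prop where
  nil : s [] = 0
  cons : ∀ a w, s (a :: w) = s w + (φ w).countP (· < a)
  le : ∀ w, φ w ≤ (w : Multiset ℕ)
  insert : ∀ a, ∃ f : List ℕ → List ℕ, Function.Injective f ∧
    (∀ w, (f w : Multiset ℕ) = a ::ₘ (w : Multiset ℕ)) ∧ (∀ w, s (f w) = s w) ∧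
    (∀ w, φ (f w) = a ::ₘ φ w) ∧ ∀ w, a ∈ φ w → ∃ v, f v = w

/-- The joint distribution of `(φ, s)` on the rearrangements of `c`. -/
noncomputable def jointDist (s : List ℕ → ℕ) (φ : List ℕ → Multiset ℕ) (c : Multiset ℕ) :
    Multiset (Multiset ℕ × ℕ) :=
  (rearrangements c).val.map fun w => (φ w, s w)

theorem count_jointDist (s : List ℕ → ℕ) (φ : List ℕ → Multiset ℕ) (c m : Multiset ℕ) (e : ℕ) :
    (jointDist s φ c).count (m, e) =
      ((rearrangements c).filter fun w => φ w = m ∧ s w = e).card := by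
  rw [jointDist, Multiset.count_map, Finset.card_def, Finset.filter_val]
  congr 1
  refine Multiset.filter_congr fun w _ => ?_
  rw [Prod.mk.injEq]
  exact ⟨fun h => ⟨h.1.symm, h.2.symm⟩, fun h => ⟨h.1.symm, h.2.symm⟩⟩

namespace IsPrependInsert

variable {s s' : List ℕ → ℕ} {φ φ' : List ℕ → Multiset ℕ}

theorem count_cons_cons (h : IsPrependInsert s φ) (a : ℕ) (c m : Multiset ℕ) (e : ℕ) :
    (jointDist s φ (a ::ₘ c)).count (a ::ₘ m, e) = (jointDist s φ c).count (m, e) := by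
  obtain ⟨f, hf, hc, hs, hφ, hsurj⟩ := h.insert a
  rw [count_jointDist, count_jointDist]
  symm
  refine Finset.card_bij (fun w _ => f w) ?_ (fun _ _ _ _ hw => hf hw) ?_
  · intro w hw
    rw [Finset.mem_filter, mem_rearrangements] at hw ⊢
    rw [hc, hs, hφ, hw.1, hw.2.1]
    exact ⟨rfl, rfl, hw.2.2⟩
  · intro w hw
    rw [Finset.mem_filter, mem_rearrangements] at hw
    obtain ⟨v, rfl⟩ := hsurj w (by rw [hw.2.1]; exact Multiset.mem_cons_self a m)
    rw [hc, hs, hφ, Multiset.cons_inj_right, Multiset.cons_inj_right] at hw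
    exact ⟨v, by rw [Finset.mem_filter, mem_rearrangements]; exact hw, rfl⟩

theorem count_eq_zero (h : IsPrependInsert s φ) {c m : Multiset ℕ} (hm : ¬ m ≤ c) (e : ℕ) :
    (jointDist s φ c).count (m, e) = 0 := by
  rw [count_jointDist, Finset.card_eq_zero, Finset.filter_eq_empty_iff]
  rintro w hw ⟨rfl, -⟩
  rw [mem_rearrangements] at hw
  exact hm (hw ▸ h.le w)

theorem map_snd_jointDist (h : IsPrependInsert s φ) {c : Multiset ℕ} (hc : c ≠ 0) :
    (jointDist s φ c).map Prod.snd =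
      c.toFinset.val.bind fun a =>
        (jointDist s φ (c.erase a)).map fun p => p.2 + p.1.countP (· < a) := by
  have key : (rearrangements c).val =
      c.toFinset.val.bind fun a => (rearrangements (c.erase a)).val.map (List.cons a) := by
    refine (Multiset.Nodup.ext (rearrangements c).nodup ?_).2 ?_
    · rw [Multiset.nodup_bind]
      refine ⟨fun a _ => (rearrangements _).nodup.map (List.cons_injective), ?_⟩
      refine Multiset.Nodup.pairwise (fun a _ b _ hab => ?_) c.toFinset.nodup
      rw [Function.onFun, Multiset.disjoint_left]
      rintro w hw hw'
      obtain ⟨u, -, rfl⟩ := Multiset.mem_map.1 hw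
      obtain ⟨v, -, hv⟩ := Multiset.mem_map.1 hw'
      exact hab (List.cons.inj hv).1.symm
    · intro w
      simp only [Multiset.mem_bind, Multiset.mem_map, Finset.mem_val, mem_rearrangements,
        Multiset.mem_toFinset]
      constructor
      · rintro rfl
        cases w with
        | nil => exact absurd rfl hc
        | cons a v => exact ⟨a, by simp, v, by simp, rfl⟩
      · rintro ⟨a, ha, v, hv, rfl⟩
        rw [← Multiset.cons_coe, hv, Multiset.cons_erase ha]
  rw [jointDist, key]
  simp only [Multiset.map_bind, Multiset.map_map, jointDist, Function.comp_def, h.cons]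

theorem jointDist_eq (h : IsPrependInsert s φ) (h' : IsPrependInsert s' φ') (c : Multiset ℕ) :
    jointDist s φ c = jointDist s' φ' c := by
  induction c using Multiset.strongInductionOn with
  | ih c ih =>
  have hpos : ∀ m e, m ≠ 0 →
      (jointDist s φ c).count (m, e) = (jointDist s' φ' c).count (m, e) := by
    intro m e hm
    by_cases hle : m ≤ c
    · obtain ⟨a, ha⟩ := Multiset.exists_mem_of_ne_zero hm
      obtain ⟨m, rfl⟩ := Multiset.exists_cons_of_mem ha
      obtain ⟨c, rfl⟩ := Multiset.exists_cons_of_mem (Multiset.mem_of_le hle ha)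
      rw [h.count_cons_cons, h'.count_cons_cons, ih c (Multiset.lt_cons_self c a)]
    · rw [h.count_eq_zero hle, h'.count_eq_zero hle]
  have hsnd : (jointDist s φ c).map Prod.snd = (jointDist s' φ' c).map Prod.snd := by
    rcases eq_or_ne c 0 with rfl | hc
    · have h0 : rearrangements 0 = {[]} := by
        ext w
        rw [mem_rearrangements, Multiset.coe_eq_zero, Finset.mem_singleton]
      simp [jointDist, h0, h.nil, h'.nil]
    · rw [h.map_snd_jointDist hc, h'.map_snd_jointDist hc]
      refine Multiset.bind_congr fun a ha => ?_
      rw [ih]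
      exact Multiset.erase_lt.2 (Multiset.mem_toFinset.1 ha)
  have hne : (jointDist s φ c).filter (fun p => p.1 ≠ 0) =
      (jointDist s' φ' c).filter fun p => p.1 ≠ 0 := by
    ext ⟨m, e⟩
    rw [Multiset.count_filter, Multiset.count_filter]
    split_ifs with hm
    · exact hpos m e hm
    · rfl
  have hzero : ((jointDist s φ c).filter fun p => p.1 = 0).map Prod.snd =
      ((jointDist s' φ' c).filter fun p => p.1 = 0).map Prod.snd := by
    rw [← Multiset.filter_add_not (fun p : Multiset ℕ × ℕ => p.1 = 0) (jointDist s φ c),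
      ← Multiset.filter_add_not (fun p : Multiset ℕ × ℕ => p.1 = 0) (jointDist s' φ' c),
      Multiset.map_add, Multiset.map_add, hne] at hsnd
    exact add_right_cancel hsnd
  ext ⟨m, e⟩
  by_cases hm : m = 0
  · subst hm
    have hcount : ∀ M : Multiset (Multiset ℕ × ℕ),
        M.count (0, e) = ((M.filter fun p => p.1 = 0).map Prod.snd).count e := by
      intro M
      rw [Multiset.count_map, Multiset.filter_filter, Multiset.count_eq_card_filter_eq]
      congr 1
      refine Multiset.filter_congr fun p _ => ?_
      rw [Prod.ext_iff]
      exact ⟨fun hp => ⟨hp.2, hp.1.symm⟩, fun hp => ⟨hp.2.symm, hp.1⟩⟩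
    rw [hcount, hcount, hzero]
  · exact hpos m e hm

end IsPrependInsert

/-- The increasing prefix `u` of the hook-factorization of a word, together with the total number
of inversions of the hooks, computed by prepending letters one at a time. -/
def hookPrefix : List ℕ → List ℕ × ℕ
  | [] => ([], 0)
  | a :: w =>
    if ∀ b ∈ (hookPrefix w).1.head?, a ≤ b then (a :: (hookPrefix w).1, (hookPrefix w).2)
    else ([], (hookPrefix w).2 + (hookPrefix w).1.countP (· < a))

theorem hookPrefix_append {v : List ℕ} (hv : (hookPrefix v).1 = []) (u : List ℕ) :
    hookPrefix (u ++ v) = ((hookPrefix u).1, (hookPrefix u).2 + (hookPrefix v).2) := by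
  induction u with
  | nil => rw [List.nil_append, Prod.ext_iff]; simp [hookPrefix, hv]
  | cons a u ih =>
    rw [List.cons_append, hookPrefix, hookPrefix, ih]
    split_ifs
    · rfl
    · simp only [Prod.mk.injEq, true_and]
      omega

theorem head?_forall_le_iff {u : List ℕ} (hu : u.Pairwise (· ≤ ·)) (a : ℕ) :
    (∀ b ∈ u.head?, a ≤ b) ↔ ∀ b ∈ u, a ≤ b := by
  cases u with
  | nil => simp
  | cons x u =>
    rw [List.pairwise_cons] at hu
    simp only [List.head?_cons, Option.mem_some_iff, forall_eq', List.mem_cons, forall_eq_or_imp]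
    exact ⟨fun h => ⟨h, fun b hb => h.trans (hu.1 b hb)⟩, fun h => h.1⟩

theorem hookPrefix_of_pairwise {u : List ℕ} (hu : u.Pairwise (· ≤ ·)) :
    hookPrefix u = (u, 0) := by
  induction u with
  | nil => rfl
  | cons a u ih =>
    rw [List.pairwise_cons] at hu
    rw [hookPrefix, ih hu.2, if_pos ((head?_forall_le_iff hu.2 a).2 hu.1)]

theorem exists_append_hookPrefix (w : List ℕ) :
    (hookPrefix w).1.Pairwise (· ≤ ·) ∧
      ∃ v, w = (hookPrefix w).1 ++ v ∧ (hookPrefix v).1 = [] := by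
  induction w with
  | nil => exact ⟨List.Pairwise.nil, [], rfl, rfl⟩
  | cons a w ih =>
    obtain ⟨hs, v, hw, hv⟩ := ih
    by_cases h : ∀ b ∈ (hookPrefix w).1.head?, a ≤ b
    · have h1 : (hookPrefix (a :: w)).1 = a :: (hookPrefix w).1 := by
        rw [hookPrefix, if_pos h]
      rw [h1]
      refine ⟨List.pairwise_cons.2 ⟨(head?_forall_le_iff hs a).1 h, hs⟩, v, ?_, hv⟩
      rw [List.cons_append, ← hw]
    · have h1 : (hookPrefix (a :: w)).1 = [] := by
        rw [hookPrefix, if_neg h]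
      exact ⟨h1 ▸ List.Pairwise.nil, a :: w, by rw [h1]; rfl, h1⟩

theorem hookPrefix_append_of_pairwise {u v : List ℕ} (hu : u.Pairwise (· ≤ ·))
    (hv : (hookPrefix v).1 = []) : hookPrefix (u ++ v) = (u, (hookPrefix v).2) := by
  rw [hookPrefix_append hv, hookPrefix_of_pairwise hu, zero_add]

/-- Insert a letter into the increasing prefix of the hook-factorization. -/
def hookInsert (a : ℕ) (w : List ℕ) : List ℕ :=
  (hookPrefix w).1.orderedInsert (· ≤ ·) a ++ w.drop (hookPrefix w).1.length

theorem hookInsert_append {u v : List ℕ} (hu : u.Pairwise (· ≤ ·)) (hv : (hookPrefix v).1 = [])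
    (a : ℕ) : hookInsert a (u ++ v) = u.orderedInsert (· ≤ ·) a ++ v := by
  rw [hookInsert, hookPrefix_append_of_pairwise hu hv, List.drop_left]

theorem isPrependInsert_hookPrefix :
    IsPrependInsert (fun w => (hookPrefix w).2) (fun w => ((hookPrefix w).1 : Multiset ℕ)) where
  nil := rfl
  cons a w := by
    obtain ⟨hs, -⟩ := exists_append_hookPrefix w
    rw [hookPrefix, Multiset.coe_countP]
    split_ifs with h
    · rw [head?_forall_le_iff hs] at h
      rw [List.countP_eq_zero.2, add_zero]
      intro b hb
      simpa using h b hb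
    · rfl
  le w := by
    obtain ⟨-, v, hw, -⟩ := exists_append_hookPrefix w
    rw [Multiset.coe_le]
    conv_rhs => rw [hw]
    exact (List.sublist_append_left _ _).subperm
  insert a := by
    have key : ∀ w, ∃ u v, w = u ++ v ∧ u.Pairwise (· ≤ ·) ∧ (hookPrefix v).1 = [] := by
      intro w
      obtain ⟨hs, v, hw, hv⟩ := exists_append_hookPrefix w
      exact ⟨_, v, hw, hs, hv⟩
    have hval : ∀ {u v : List ℕ}, u.Pairwise (· ≤ ·) → (hookPrefix v).1 = [] →
        hookPrefix (hookInsert a (u ++ v)) = (u.orderedInsert (· ≤ ·) a, (hookPrefix v).2) := by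
      intro u v hu hv
      rw [hookInsert_append hu hv, hookPrefix_append_of_pairwise (hu.orderedInsert a u) hv]
    refine ⟨hookInsert a, ?_, ?_, ?_, ?_, ?_⟩
    · intro w w' h
      obtain ⟨u, v, rfl, hu, hv⟩ := key w
      obtain ⟨u', v', rfl, hu', hv'⟩ := key w'
      have h1 : u.orderedInsert (· ≤ ·) a = u'.orderedInsert (· ≤ ·) a := by
        have h2 := congrArg (fun w => (hookPrefix w).1) h
        simpa only [hval hu hv, hval hu' hv'] using h2
      have hp : u.Perm u' := by
        have h2 := (List.perm_orderedInsert (· ≤ ·) a u).symm.trans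
          (h1 ▸ List.perm_orderedInsert (· ≤ ·) a u')
        exact h2.cons_inv
      obtain rfl : u = u' := List.Perm.eq_of_pairwise' hu hu' hp
      rw [hookInsert_append hu hv, hookInsert_append hu hv', List.append_cancel_left_eq] at h
      rw [h]
    · intro w
      obtain ⟨u, v, rfl, hu, hv⟩ := key w
      rw [hookInsert_append hu hv, Multiset.cons_coe, Multiset.coe_eq_coe]
      exact (List.perm_orderedInsert (· ≤ ·) a u).append_right v
    · intro w
      obtain ⟨u, v, rfl, hu, hv⟩ := key w
      rw [hval hu hv, hookPrefix_append_of_pairwise hu hv]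
    · intro w
      obtain ⟨u, v, rfl, hu, hv⟩ := key w
      rw [hval hu hv, hookPrefix_append_of_pairwise hu hv, Multiset.cons_coe,
        Multiset.coe_eq_coe]
      exact List.perm_orderedInsert (· ≤ ·) a u
    · intro w ha
      obtain ⟨u, v, rfl, hu, hv⟩ := key w
      rw [hookPrefix_append_of_pairwise hu hv, Multiset.mem_coe] at ha
      have hu' := hu.sublist (List.erase_sublist (a := a))
      refine ⟨u.erase a ++ v, ?_⟩
      rw [hookInsert_append hu' hv, List.append_cancel_right_eq]
      refine List.Perm.eq_of_pairwise' (hu'.orderedInsert a _) hu ?_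
      exact (List.perm_orderedInsert (· ≤ ·) a _).trans (List.perm_cons_erase ha).symm

theorem decSplit_spec (r : List ℕ) :
    r = (decSplit r).1 ++ (decSplit r).2 ∧ (decSplit r).1.Pairwise (· ≥ ·) ∧
      ∀ a ∈ (decSplit r).2.head?, ∃ b ∈ (decSplit r).1.getLast?, b < a := by
  induction r using decSplit.induct with
  | case1 => simp [decSplit]
  | case2 x => simp [decSplit]
  | case3 x y t h ih =>
    have hsplit : decSplit (x :: y :: t) =
        (x :: (decSplit (y :: t)).1, (decSplit (y :: t)).2) := by
      rw [decSplit, if_pos h]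
    obtain ⟨h1, h2, h3⟩ := ih
    have hne : (decSplit (y :: t)).1 ≠ [] := by
      cases t with
      | nil => simp [decSplit]
      | cons z t => rw [decSplit]; split_ifs <;> simp
    obtain ⟨z, q, hq⟩ := List.exists_cons_of_ne_nil hne
    rw [hsplit]
    rw [hq] at h1 h2 h3 ⊢
    obtain ⟨rfl, h1⟩ := List.cons.inj h1
    refine ⟨congrArg (List.cons x) h1, ?_, ?_⟩
    · rw [List.pairwise_cons]
      refine ⟨fun b hb => ?_, h2⟩
      rcases List.mem_cons.1 hb with rfl | hb
      · exact h
      · exact ((List.pairwise_cons.1 h2).1 b hb).trans h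
    · simpa [List.getLast?_cons_cons] using h3
  | case4 x y t h =>
    rw [decSplit, if_neg h]
    simpa using h

theorem hookPrefix_eq_of_fuel (fuel : ℕ) (r : List ℕ) (hr : r.length ≤ fuel) :
    hookPrefix r.reverse = ((hookPrefix r.reverse).1, lecAux fuel r) ∧
      (hookPrefix r.reverse).1.length = pixAux fuel r := by
  induction fuel generalizing r with
  | zero =>
    obtain rfl : r = [] := by simpa using hr
    exact ⟨rfl, rfl⟩
  | succ fuel ih =>
    obtain ⟨h1, h2, h3⟩ := decSplit_spec r
    have h2' : (decSplit r).1.reverse.Pairwise (· ≤ ·) := List.pairwise_reverse.2 h2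
    have hlec : lecAux (fuel + 1) r = match (decSplit r).2 with
        | [] => 0
        | a :: r' => ((decSplit r).1.filter fun x => x < a).length + lecAux fuel r' := by
      cases r <;> rfl
    rw [hlec, pixAux]
    cases hd : (decSplit r).2 with
    | nil =>
      rw [hd, List.append_nil] at h1
      rw [← h1] at h2' ⊢
      rw [hookPrefix_of_pairwise h2']
      simp
    | cons a r' =>
      rw [hd] at h1 h3
      obtain ⟨b, hb, hba⟩ := h3 a rfl
      have hhook : hookPrefix (a :: (decSplit r).1.reverse) =
          ([], ((decSplit r).1.filter fun x => x < a).length) := by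
        rw [hookPrefix, hookPrefix_of_pairwise h2', if_neg]
        · simp [List.countP_eq_length_filter]
        · intro h
          exact absurd (h b (by rwa [List.head?_reverse])) (not_le.2 hba)
      have hlen : r'.length ≤ fuel := by
        have := congrArg List.length h1
        simp only [List.length_append, List.length_cons] at this
        omega
      obtain ⟨ih1, ih2⟩ := ih r' hlen
      have hrev : r.reverse = r'.reverse ++ a :: (decSplit r).1.reverse := by
        conv_lhs => rw [h1]
        simp
      rw [hrev, hookPrefix_append (by rw [hhook]), hhook]
      refine ⟨?_, ih2⟩
      rw [ih1]
      simp [add_comm]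

theorem lec_eq_hookPrefix (w : List ℕ) : lec w = (hookPrefix w).2 := by
  have h := (hookPrefix_eq_of_fuel w.length w.reverse (by simp)).1
  rw [List.reverse_reverse] at h
  rw [lec, h]

theorem pix_eq_hookPrefix (w : List ℕ) : pix w = (hookPrefix w).1.length := by
  have h := (hookPrefix_eq_of_fuel w.length w.reverse (by simp)).2
  rw [List.reverse_reverse] at h
  rw [pix, h]

/-- The hook-factorization only depends on the positions of the descents and the strict
comparisons between letters, hence is preserved by a map compatible with them. -/
theorem hookPrefix_map {B : ℕ → ℕ} {w : List ℕ}
    (hw : w.Pairwise fun x y => (y < x ↔ B y < B x)) :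
    hookPrefix (w.map B) = ((hookPrefix w).1.map B, (hookPrefix w).2) := by
  induction w with
  | nil => rfl
  | cons a w ih =>
    rw [List.pairwise_cons] at hw
    have hsub : ∀ b ∈ (hookPrefix w).1, (b < a ↔ B b < B a) := by
      intro b hb
      obtain ⟨-, v, hv, -⟩ := exists_append_hookPrefix w
      exact hw.1 b (hv ▸ List.mem_append_left v hb)
    have hcond : (∀ b ∈ ((hookPrefix w).1.map B).head?, B a ≤ b) ↔
        ∀ b ∈ (hookPrefix w).1.head?, a ≤ b := by
      rw [List.head?_map]
      cases hh : (hookPrefix w).1.head? with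
      | none => simp
      | some b =>
        have := hsub b (List.mem_of_head? hh)
        simp only [Option.map_some, Option.mem_some_iff, forall_eq']
        omega
    have hcount : ((hookPrefix w).1.map B).countP (· < B a) =
        (hookPrefix w).1.countP (· < a) := by
      rw [List.countP_map]
      refine List.countP_congr fun b hb => ?_
      simpa using (hsub b hb).symm
    rw [List.map_cons, hookPrefix, hookPrefix, ih hw.2, hcount]
    simp only [hcond]
    split_ifs <;> rfl

/-- The letters `x` of `w`, read in the word obtained by putting the letters of `L` before and those
of `R` after `w`, for which the number of larger letters to the left of `x` compares as `o` with the
number of smaller letters to the right of `x`. -/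
def ctxFilter (o : Ordering) : List ℕ → List ℕ → List ℕ → Multiset ℕ
  | _, [], _ => 0
  | L, x :: w, R =>
    (if compare (L.countP (x < ·)) ((w ++ R).countP (· < x)) = o then {x} else 0) +
      ctxFilter o (x :: L) w R

theorem ctxFilter_perm (o : Ordering) (w : List ℕ) {L L' : List ℕ} (hL : L.Perm L')
    (R : List ℕ) : ctxFilter o L w R = ctxFilter o L' w R := by
  induction w generalizing L L' with
  | nil => rfl
  | cons x w ih => rw [ctxFilter, ctxFilter, hL.countP_eq, ih (hL.cons x)]

theorem ctxFilter_append (o : Ordering) (L l r R : List ℕ) :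
    ctxFilter o L (l ++ r) R = ctxFilter o L l (r ++ R) + ctxFilter o (l ++ L) r R := by
  induction l generalizing L with
  | nil => simp [ctxFilter]
  | cons x l ih =>
    rw [List.cons_append, ctxFilter, ctxFilter, ih, List.append_assoc, add_assoc,
      ctxFilter_perm o r (List.perm_middle : (l ++ x :: L).Perm (x :: (l ++ L)))]
    rfl

theorem ctxFilter_le (o : Ordering) (L w R : List ℕ) :
    ctxFilter o L w R ≤ (w : Multiset ℕ) := by
  induction w generalizing L with
  | nil => exact le_rfl
  | cons x w ih =>
    rw [ctxFilter, ← Multiset.cons_coe, ← Multiset.singleton_add]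
    refine add_le_add ?_ (ih _)
    split_ifs
    · exact le_rfl
    · exact Multiset.zero_le _

theorem card_ctxFilter_cons (a : ℕ) (L w R : List ℕ) :
    (ctxFilter .gt (a :: L) w R).card =
      (ctxFilter .gt L w R).card + (ctxFilter .eq L w R).countP (· < a) := by
  induction w generalizing L with
  | nil => rfl
  | cons x w ih =>
    rw [ctxFilter, ctxFilter, ctxFilter, ctxFilter_perm .gt w (List.Perm.swap a x L),
      Multiset.card_add, Multiset.card_add, Multiset.countP_add, ih, List.countP_cons]
    generalize L.countP (x < ·) = p
    generalize (w ++ R).countP (· < x) = q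
    simp only [compare_gt_iff_gt, compare_eq_iff_eq, decide_eq_true_eq]
    have h1 : ∀ s : Prop, [Decidable s] →
        (if s then ({x} : Multiset ℕ) else 0).card = if s then 1 else 0 := by
      intro s _; split_ifs <;> rfl
    have h2 : (if p = q then ({x} : Multiset ℕ) else 0).countP (· < a) =
        if p = q ∧ x < a then 1 else 0 := by
      by_cases hx : x < a <;> by_cases hp : p = q <;>
        simp [hx, hp, Multiset.countP_eq_card_filter, Multiset.filter_singleton]
    rw [h1, h1, h2]
    split_ifs <;> omega

theorem countP_lt_mono {x y : ℕ} (h : x ≤ y) (w : List ℕ) :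
    w.countP (· < x) ≤ w.countP (· < y) :=
  List.countP_mono_left fun z _ hz => by simp only [decide_eq_true_eq] at *; omega

theorem countP_gt_anti {x y : ℕ} (h : x ≤ y) (w : List ℕ) :
    w.countP (y < ·) ≤ w.countP (x < ·) :=
  List.countP_mono_left fun z _ hz => by simp only [decide_eq_true_eq] at *; omega

theorem ctxFilter_cons_right (o : Ordering) (a : ℕ) (L l R : List ℕ)
    (h : L.countP (a < ·) + l.countP (a < ·) ≤ R.countP (· < a)) :
    ctxFilter o L l (a :: R) = ctxFilter o L l R := by
  induction l generalizing L with
  | nil => rfl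
  | cons x l ih =>
    rw [List.countP_cons] at h
    rw [ctxFilter, ctxFilter, ih (x :: L) (by rw [List.countP_cons]; omega)]
    congr 1
    by_cases hx : a < x
    · have h1 := countP_gt_anti hx.le L
      have h2 := countP_lt_mono hx.le R
      simp only [hx, decide_true, if_true] at h
      rw [compare_lt_iff_lt.2, compare_lt_iff_lt.2]
      · rw [List.countP_append]; omega
      · rw [List.countP_append, List.countP_cons]; omega
    · simp [List.countP_append, hx]

theorem ctxFilter_cons_left (o : Ordering) (a : ℕ) (L r R : List ℕ)
    (h : (r ++ R).countP (· < a) ≤ L.countP (a < ·)) :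
    ctxFilter o (a :: L) r R = ctxFilter o L r R := by
  induction r generalizing L with
  | nil => rfl
  | cons x r ih =>
    rw [List.cons_append, List.countP_cons] at h
    rw [ctxFilter, ctxFilter, ctxFilter_perm o r (List.Perm.swap a x L),
      ih (x :: L) (by rw [List.countP_cons]; omega)]
    congr 1
    by_cases hx : x < a
    · have h1 := countP_gt_anti hx.le L
      have h2 := countP_lt_mono hx.le (r ++ R)
      simp only [hx, decide_true, if_true] at h
      rw [compare_gt_iff_gt.2, compare_gt_iff_gt.2]
      · omega
      · rw [List.countP_cons]; omega
    · simp [hx]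

theorem ctxFilter_insert (o : Ordering) {a : ℕ} {l r : List ℕ}
    (h : l.countP (a < ·) = r.countP (· < a)) :
    ctxFilter o [] (l ++ a :: r) [] =
      (if o = .eq then {a} else 0) + ctxFilter o [] (l ++ r) [] := by
  rw [ctxFilter_append, ctxFilter_append, ctxFilter, List.append_nil, List.append_nil,
    List.append_nil, ctxFilter_cons_left, ctxFilter_cons_right, h,
    compare_eq_iff_eq.2 rfl, add_left_comm]
  · simp only [eq_comm]
  · simp [h]
  · simp [h]

theorem exists_gap (a : ℕ) (L w : List ℕ) (h : L.countP (a < ·) ≤ w.countP (· < a)) :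
    ∃ l r, w = l ++ r ∧ L.countP (a < ·) + l.countP (a < ·) = r.countP (· < a) := by
  induction w generalizing L with
  | nil => exact ⟨[], [], rfl, by simpa using h⟩
  | cons x w ih =>
    rcases h.eq_or_lt with h | h
    · exact ⟨[], x :: w, rfl, by simpa using h⟩
    · obtain ⟨l, r, rfl, hlr⟩ := ih (x :: L) (by
        rw [List.countP_cons] at h ⊢
        simp only [decide_eq_true_eq] at *
        split_ifs at * <;> omega)
      refine ⟨x :: l, r, rfl, ?_⟩
      rw [List.countP_cons] at hlr ⊢
      omega

theorem exists_gap_of_mem_ctxFilter {a : ℕ} {L w R : List ℕ} (h : a ∈ ctxFilter .eq L w R) :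
    ∃ l r, w = l ++ a :: r ∧
      L.countP (a < ·) + l.countP (a < ·) = (r ++ R).countP (· < a) := by
  induction w generalizing L with
  | nil => exact absurd h (Multiset.notMem_zero a)
  | cons x w ih =>
    rw [ctxFilter, Multiset.mem_add] at h
    rcases h with h | h
    · split_ifs at h with hc
      · obtain rfl := Multiset.mem_singleton.1 h
        exact ⟨[], w, rfl, by simpa using compare_eq_iff_eq.1 hc⟩
      · exact absurd h (Multiset.notMem_zero a)
    · obtain ⟨l, r, rfl, hlr⟩ := ih h
      refine ⟨x :: l, r, rfl, ?_⟩
      rw [List.countP_cons] at hlr ⊢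
      omega

theorem cons_eq_append_singleton {a : ℕ} {m : List ℕ}
    (h : m.countP (a < ·) + m.countP (· < a) = 0) : a :: m = m ++ [a] := by
  have hm : m = List.replicate m.length a := by
    rw [List.eq_replicate_iff]
    refine ⟨rfl, fun b hb => ?_⟩
    have h1 := List.countP_eq_zero.1 (Nat.eq_zero_of_add_eq_zero_right h) b hb
    have h2 := List.countP_eq_zero.1 (Nat.eq_zero_of_add_eq_zero_left h) b hb
    simp only [decide_eq_true_eq] at h1 h2
    omega
  rw [hm, ← List.replicate_succ, ← List.replicate_succ']

theorem insert_eq_of_append_eq {a : ℕ} {l r l' r' : List ℕ}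
    (h : l.countP (a < ·) = r.countP (· < a)) (h' : l'.countP (a < ·) = r'.countP (· < a))
    (he : l ++ r = l' ++ r') : l ++ a :: r = l' ++ a :: r' := by
  wlog hl : ∃ m, l' = l ++ m ∧ r = m ++ r' generalizing l r l' r'
  · rcases List.append_eq_append_iff.1 he with h1 | ⟨m, h1, h2⟩
    · exact absurd h1 hl
    · exact (this h' h he.symm ⟨m, h1, h2⟩).symm
  obtain ⟨m, rfl, rfl⟩ := hl
  rw [List.countP_append] at h h'
  have := cons_eq_append_singleton (a := a) (m := m) (by omega)
  rw [← List.cons_append, this]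
  simp

theorem append_eq_of_insert_eq {a : ℕ} {l r l' r' : List ℕ}
    (h : l.countP (a < ·) = r.countP (· < a)) (h' : l'.countP (a < ·) = r'.countP (· < a))
    (he : l ++ a :: r = l' ++ a :: r') : l ++ r = l' ++ r' := by
  wlog hl : ∃ m, l' = l ++ m ∧ a :: r = m ++ a :: r' generalizing l r l' r'
  · rcases List.append_eq_append_iff.1 he with h1 | ⟨m, h1, h2⟩
    · exact absurd h1 hl
    · exact (this h' h he.symm ⟨m, h1, h2⟩).symm
  obtain ⟨m, rfl, hm⟩ := hl
  cases m with
  | nil =>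
    rw [List.nil_append, List.cons.injEq] at hm
    rw [List.append_nil, hm.2]
  | cons b m =>
    rw [List.cons_append, List.cons.injEq] at hm
    obtain ⟨rfl, rfl⟩ := hm
    simp only [List.countP_append, List.countP_cons, lt_irrefl, decide_false] at h h'
    have := cons_eq_append_singleton (a := a) (m := m) (by simp at h h'; omega)
    rw [this]
    simp

theorem isPrependInsert_ctxFilter :
    IsPrependInsert (fun w => (ctxFilter .gt [] w []).card) (fun w => ctxFilter .eq [] w []) where
  nil := rfl
  cons a w := by
    rw [ctxFilter, Multiset.card_add, card_ctxFilter_cons, if_neg]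
    · simp
    · simp [compare_gt_iff_gt]
  le w := ctxFilter_le .eq [] w []
  insert a := by
    have key : ∀ w : List ℕ, ∃ p : List ℕ × List ℕ,
        w = p.1 ++ p.2 ∧ p.1.countP (a < ·) = p.2.countP (· < a) := by
      intro w
      obtain ⟨l, r, hw, h⟩ := exists_gap a [] w (Nat.zero_le _)
      exact ⟨(l, r), hw, by simpa using h⟩
    choose g hg hgap using key
    refine ⟨fun w => (g w).1 ++ a :: (g w).2, ?_, ?_, ?_, ?_, ?_⟩
    · intro w w' h
      rw [hg w, hg w']
      exact append_eq_of_insert_eq (hgap w) (hgap w') h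
    · intro w
      rw [Multiset.cons_coe, Multiset.coe_eq_coe]
      conv_rhs => rw [hg w]
      exact List.perm_middle
    · intro w
      conv_rhs => rw [hg w]
      simp [ctxFilter_insert .gt (hgap w)]
    · intro w
      conv_rhs => rw [hg w]
      simp [ctxFilter_insert .eq (hgap w)]
    · intro w ha
      obtain ⟨l, r, rfl, h⟩ := exists_gap_of_mem_ctxFilter ha
      refine ⟨l ++ r, insert_eq_of_append_eq (hgap _) (by simpa using h) (hg _).symm⟩

theorem ctxFilter_map (o : Ordering) {B : ℕ → ℕ} {L w : List ℕ}
    (hL : ∀ x ∈ L, ∀ y ∈ w, (y < x ↔ B y < B x))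
    (hw : w.Pairwise fun x y => (y < x ↔ B y < B x)) :
    ctxFilter o (L.map B) (w.map B) [] = (ctxFilter o L w []).map B := by
  induction w generalizing L with
  | nil => rfl
  | cons x w ih =>
    rw [List.pairwise_cons] at hw
    have h1 : (L.map B).countP (B x < ·) = L.countP (x < ·) := by
      rw [List.countP_map]
      refine List.countP_congr fun y hy => ?_
      simpa using (hL y hy x List.mem_cons_self).symm
    have h2 : (w.map B).countP (· < B x) = w.countP (· < x) := by
      rw [List.countP_map]
      refine List.countP_congr fun y hy => ?_
      simpa using (hw.1 y hy).symm
    rw [List.map_cons, ctxFilter, ctxFilter, List.append_nil, List.append_nil, h1, h2,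
      Multiset.map_add, ← List.map_cons, ih _ hw.2]
    · congr 1
      split_ifs <;> rfl
    · intro z hz y hy
      rcases List.mem_cons.1 hz with rfl | hz
      · exact hw.1 y hy
      · exact hL z hz y (List.mem_cons_of_mem x hy)

theorem card_ctxFilter_ofFn (o : Ordering) {n m : ℕ} (f : Fin m → ℕ) (L : List ℕ)
    (h : (L ++ List.ofFn f).Perm (List.range' 1 n)) :
    (ctxFilter o L (List.ofFn f) []).card =
      ∑ i : Fin m, if compare (L.length + i + 1) (f i) = o then 1 else 0 := by
  induction m generalizing L with
  | zero => rfl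
  | succ m ih =>
    rw [List.ofFn_succ] at h ⊢
    have hperm : (f 0 :: L ++ List.ofFn fun i => f i.succ).Perm (List.range' 1 n) :=
      List.perm_middle.symm.trans h
    have hnd : (f 0 :: L ++ List.ofFn fun i => f i.succ).Nodup :=
      hperm.nodup_iff.2 List.nodup_range'
    have hmem : f 0 ∈ List.range' 1 n := hperm.subset (by simp)
    rw [List.mem_range'_1] at hmem
    have hlt : (List.range' 1 n).countP (· < f 0) = f 0 - 1 := by
      have h1 : List.range' 1 n = List.range' 1 (f 0 - 1) ++ List.range' (f 0) (n + 1 - f 0) := by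
        have := List.range'_append (s := 1) (m := f 0 - 1) (n := n + 1 - f 0) (step := 1)
        rw [show 1 + 1 * (f 0 - 1) = f 0 by omega,
          show f 0 - 1 + (n + 1 - f 0) = n by omega] at this
        exact this.symm
      rw [h1, List.countP_append, List.countP_eq_length.2, List.countP_eq_zero.2]
      · simp
      · intro b hb
        rw [List.mem_range'_1] at hb
        simp only [decide_eq_true_eq]
        omega
      · intro b hb
        rw [List.mem_range'_1] at hb
        simp only [decide_eq_true_eq]
        omega
    have hcount := hperm.countP_eq (· < f 0)
    rw [hlt, List.countP_append, List.countP_cons_of_neg (by simp)] at hcount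
    have hlen : L.length = L.countP (f 0 < ·) + L.countP (· < f 0) := by
      rw [List.length_eq_countP_add_countP (f 0 < ·)]
      congr 1
      refine List.countP_congr fun b hb => ?_
      have hne : b ≠ f 0 := by
        rintro rfl
        rw [List.cons_append, List.nodup_cons] at hnd
        exact hnd.1 (List.mem_append_left _ hb)
      simp only [decide_eq_true_eq]
      omega
    have hcmp : compare (L.countP (f 0 < ·)) ((List.ofFn fun i => f i.succ).countP (· < f 0)) =
        compare (L.length + 1) (f 0) := by
      rcases lt_trichotomy (L.length + 1) (f 0) with hc | hc | hc
      · rw [compare_lt_iff_lt.2 hc, compare_lt_iff_lt]; omega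
      · rw [compare_eq_iff_eq.2 hc, compare_eq_iff_eq]; omega
      · rw [compare_gt_iff_gt.2 hc, compare_gt_iff_gt]; omega
    rw [ctxFilter, Multiset.card_add, ih _ _ hperm, Fin.sum_univ_succ, List.append_nil, hcmp]
    congr 1
    · simp only [Fin.val_zero, add_zero]
      split_ifs <;> rfl
    · refine Finset.sum_congr rfl fun i _ => ?_
      rw [List.length_cons, Fin.val_succ,
        show L.length + 1 + (i : ℕ) + 1 = L.length + (i + 1) + 1 by omega]

theorem IsPrependInsert.card_filter_eq {s s' : List ℕ → ℕ} {φ φ' : List ℕ → Multiset ℕ}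
    (h : IsPrependInsert s φ) (h' : IsPrependInsert s' φ') (c : Multiset ℕ) (e f : ℕ) :
    ((rearrangements c).filter fun w => s w = e ∧ (φ w).card = f).card =
      ((rearrangements c).filter fun w => s' w = e ∧ (φ' w).card = f).card := by
  have key : ∀ (s : List ℕ → ℕ) (φ : List ℕ → Multiset ℕ),
      ((rearrangements c).filter fun w => s w = e ∧ (φ w).card = f).card =
        (jointDist s φ c).countP fun p => p.2 = e ∧ p.1.card = f := by
    intro s φ
    rw [jointDist, Multiset.countP_map, Finset.card_def, Finset.filter_val]
  rw [key, key, h.jointDist_eq h']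

section Permutations

variable {n : ℕ}

theorem permToFun_succ (σ : Equiv.Perm (Fin n)) (i : Fin n) :
    permToFun σ ((i : ℕ) + 1) = (σ i : ℕ) + 1 := by
  rw [permToFun, dif_pos ⟨by omega, by omega⟩]
  rfl

theorem card_filter_Icc_one (P : ℕ → Prop) [DecidablePred P] :
    ((Finset.Icc 1 n).filter P).card = ∑ i : Fin n, if P ((i : ℕ) + 1) then 1 else 0 := by
  rw [Finset.card_filter, Fin.sum_univ_eq_sum_range (fun i => if P (i + 1) then 1 else 0),
    Finset.range_eq_Ico, Finset.sum_Ico_add' (fun i => if P i then 1 else 0)]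
  rfl

theorem wordOf_perm (σ : Equiv.Perm (Fin n)) : (wordOf σ).Perm (List.range' 1 n) := by
  have h1 : List.ofFn (fun i : Fin n => (i : ℕ) + 1) = List.range' 1 n := by
    refine List.ext_getElem (by simp) fun i _ _ => ?_
    simp [add_comm]
  rw [← h1]
  exact Equiv.Perm.ofFn_comp_perm σ fun i : Fin n => (i : ℕ) + 1

theorem card_ctxFilter_eq_wordOf (σ : Equiv.Perm (Fin n)) :
    (ctxFilter .eq [] (wordOf σ) []).card = fixCount σ := by
  rw [wordOf, card_ctxFilter_ofFn .eq _ [] (wordOf_perm σ), fixCount, card_filter_Icc_one]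
  refine Finset.sum_congr rfl fun i _ => ?_
  simp only [permToFun_succ, compare_eq_iff_eq, List.length_nil, zero_add]
  simp only [eq_comm]

theorem card_ctxFilter_gt_wordOf (σ : Equiv.Perm (Fin n)) :
    (ctxFilter .gt [] (wordOf σ) []).card = excCount σ⁻¹ := by
  rw [wordOf, card_ctxFilter_ofFn .gt _ [] (wordOf_perm σ), excCount, card_filter_Icc_one,
    ← Equiv.sum_comp σ fun i => if (i : ℕ) + 1 < permToFun σ⁻¹ ((i : ℕ) + 1) then 1 else 0]
  refine Finset.sum_congr rfl fun i _ => ?_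
  simp only [permToFun_succ, compare_gt_iff_gt, List.length_nil, zero_add,
    Equiv.Perm.inv_def, Equiv.symm_apply_apply]

theorem lt_of_card_filter_lt_eq {τ : Equiv.Perm (Fin n)} {D : Finset ℕ} (hD : desSet τ ⊆ D)
    {i j : Fin n} (hij : i < j)
    (hB : (D.filter (· < (i : ℕ) + 1)).card = (D.filter (· < (j : ℕ) + 1)).card) :
    τ i < τ j := by
  obtain ⟨j, hj⟩ := j
  induction j with
  | zero => exact absurd hij (Nat.not_lt_zero _)
  | succ j ih =>
    have hstep : τ ⟨j, by omega⟩ < τ ⟨j + 1, hj⟩ := by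
      have hjD : j + 1 ∉ D := by
        intro hmem
        refine hB.not_lt (Finset.card_lt_card ?_)
        rw [Finset.ssubset_iff_of_subset]
        · refine ⟨j + 1, ?_, ?_⟩
          · simp [hmem]
          · have : (i : ℕ) < j + 1 := hij
            simp only [Finset.mem_filter, not_and, not_lt]
            omega
        · refine Finset.monotone_filter_right D fun x _ hx => ?_
          exact hx.trans (Nat.succ_lt_succ hij)
      have hdes : j + 1 ∉ desSet τ := fun h => hjD (hD h)
      rw [desSet, Finset.mem_filter, Finset.mem_Icc, not_and, not_lt] at hdes
      have h1 := hdes ⟨by omega, by omega⟩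
      rw [permToFun_succ τ ⟨j, by omega⟩, permToFun_succ τ ⟨j + 1, hj⟩] at h1
      refine lt_of_le_of_ne (by rw [Fin.le_def]; omega) fun h => ?_
      simpa using τ.injective h
    rcases (Nat.le_of_lt_succ hij).eq_or_lt with h | h
    · rwa [show i = ⟨j, by omega⟩ from Fin.ext h]
    · refine (ih (by omega) h (le_antisymm ?_ ?_)).trans hstep
      · refine Finset.card_le_card (Finset.monotone_filter_right D fun x _ hx => ?_)
        exact hx.trans (Nat.succ_lt_succ h)
      · rw [hB]
        refine Finset.card_le_card (Finset.monotone_filter_right D fun x _ hx => ?_)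
        exact hx.trans (by simp)

theorem desSet_subset {τ : Equiv.Perm (Fin n)} {D : Finset ℕ}
    (h : ∀ i j : Fin n, i < j →
      (D.filter (· < (i : ℕ) + 1)).card = (D.filter (· < (j : ℕ) + 1)).card → τ i < τ j) :
    desSet τ ⊆ D := by
  intro d hd
  rw [desSet, Finset.mem_filter, Finset.mem_Icc] at hd
  obtain ⟨⟨hd1, hd2⟩, hlt⟩ := hd
  obtain ⟨d, rfl⟩ := Nat.exists_eq_add_of_le' hd1
  by_contra hdD
  have h1 := h ⟨d, by omega⟩ ⟨d + 1, by omega⟩ (by simp [Fin.lt_def]) (by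
    congr 1
    refine Finset.filter_congr fun x hx => ?_
    have : x ≠ d + 1 := fun h => hdD (h ▸ hx)
    simp only
    omega)
  rw [permToFun_succ τ ⟨d, by omega⟩, permToFun_succ τ ⟨d + 1, by omega⟩] at hlt
  rw [Fin.lt_def] at h1
  omega

theorem card_filter_lt_mono (D : Finset ℕ) : Monotone fun x : ℕ => (D.filter (· < x)).card :=
  fun _ _ hxy =>
    Finset.card_le_card (Finset.monotone_filter_right D fun _ _ hz => lt_of_lt_of_le hz hxy)

theorem wordOf_pairwise {σ : Equiv.Perm (Fin n)} {D : Finset ℕ} (hD : desSet σ⁻¹ ⊆ D) :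
    (wordOf σ).Pairwise fun x y =>
      (y < x ↔ (D.filter (· < y)).card < (D.filter (· < x)).card) := by
  rw [wordOf, List.pairwise_ofFn]
  intro i j hij
  refine ⟨fun hlt => ?_, fun hlt => ?_⟩
  · refine lt_of_le_of_ne (card_filter_lt_mono D hlt.le) fun hB => ?_
    have := lt_of_card_filter_lt_eq hD (Fin.lt_def.2 (Nat.lt_of_succ_lt_succ hlt)) hB
    rw [Equiv.Perm.inv_def, Equiv.symm_apply_apply, Equiv.symm_apply_apply] at this
    exact this.not_gt hij
  · by_contra hle
    exact hlt.not_ge (card_filter_lt_mono D (not_lt.1 hle))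

/-- The multiset of values `#{d ∈ D : d < x}` for `x ∈ [n]`. -/
def blockContent (n : ℕ) (D : Finset ℕ) : Multiset ℕ :=
  (List.ofFn fun i : Fin n => (D.filter (· < (i : ℕ) + 1)).card : List ℕ)

theorem card_filter_desSet_inv_subset (D : Finset ℕ) (P : List ℕ → Prop) [DecidablePred P] :
    (Finset.univ.filter fun σ : Equiv.Perm (Fin n) => desSet σ⁻¹ ⊆ D ∧
        P ((wordOf σ).map fun x => (D.filter (· < x)).card)).card =
      ((rearrangements (blockContent n D)).filter P).card := by
  have hmap : ∀ σ : Equiv.Perm (Fin n), ((wordOf σ).map fun x => (D.filter (· < x)).card) =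
      List.ofFn ((fun i : Fin n => (D.filter (· < (i : ℕ) + 1)).card) ∘ σ) := by
    intro σ
    rw [wordOf, List.map_ofFn]
    rfl
  have hmono : Monotone fun i : Fin n => (D.filter (· < (i : ℕ) + 1)).card :=
    fun i j hij => card_filter_lt_mono D (Nat.succ_le_succ hij)
  refine Finset.card_bij (fun σ _ => (wordOf σ).map fun x => (D.filter (· < x)).card) ?_ ?_ ?_
  · intro σ hσ
    rw [Finset.mem_filter, mem_rearrangements, blockContent, Multiset.coe_eq_coe]
    refine ⟨?_, (Finset.mem_filter.1 hσ).2.2⟩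
    rw [hmap]
    exact Equiv.Perm.ofFn_comp_perm σ _
  · intro σ hσ σ' hσ' h
    simp only [hmap] at h
    have hf := List.ofFn_injective h
    have hsort : ∀ ρ : Equiv.Perm (Fin n), desSet ρ⁻¹ ⊆ D →
        ρ⁻¹ = Tuple.sort ((fun i : Fin n => (D.filter (· < (i : ℕ) + 1)).card) ∘ ρ) := by
      intro ρ hρ
      rw [Tuple.eq_sort_iff]
      refine ⟨?_, fun i j hij hB => ?_⟩
      · rw [Function.comp_assoc, ← Equiv.Perm.coe_mul, mul_inv_cancel]
        exact hmono
      · simp only [Function.comp_apply, Equiv.Perm.inv_def,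
          Equiv.apply_symm_apply] at hB
        exact lt_of_card_filter_lt_eq hρ hij hB
    have h1 := hsort σ (Finset.mem_filter.1 hσ).2.1
    rw [hf, ← hsort σ' (Finset.mem_filter.1 hσ').2.1] at h1
    exact inv_injective h1
  · intro w hw
    rw [Finset.mem_filter, mem_rearrangements, blockContent, Multiset.coe_eq_coe] at hw
    obtain ⟨hw, hP⟩ := hw
    have hlen : w.length = n := by simpa using hw.length_eq
    obtain ⟨f, rfl⟩ : ∃ f : Fin n → ℕ, w = List.ofFn f :=
      ⟨fun i => w[(i : ℕ)], List.ext_getElem (by simp [hlen]) (by simp)⟩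
    have hfb : f ∘ Tuple.sort f = fun i : Fin n => (D.filter (· < (i : ℕ) + 1)).card := by
      refine List.ofFn_injective (List.Perm.eq_of_pairwise' (r := (· ≤ ·)) ?_ ?_
        ((Equiv.Perm.ofFn_comp_perm _ f).trans hw))
      · exact List.pairwise_ofFn.2 fun i j hij => Tuple.monotone_sort f hij.le
      · exact List.pairwise_ofFn.2 fun i j hij => hmono hij.le
    have hword : ((wordOf (Tuple.sort f)⁻¹).map fun x => (D.filter (· < x)).card) =
        List.ofFn f := by
      rw [hmap, ← hfb, Function.comp_assoc, ← Equiv.Perm.coe_mul, mul_inv_cancel]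
      rfl
    refine ⟨(Tuple.sort f)⁻¹, ?_, hword⟩
    rw [Finset.mem_filter, hword, inv_inv]
    refine ⟨Finset.mem_univ _, desSet_subset fun i j hij hB => ?_, hP⟩
    refine (Tuple.eq_sort_iff.1 (rfl : Tuple.sort f = _)).2 i j hij ?_
    have h1 := congrFun hfb i
    have h2 := congrFun hfb j
    simp only [Function.comp_apply] at h1 h2
    rw [h1, h2, hB]

theorem card_filter_lec_pix_eq (D : Finset ℕ) (e f : ℕ) :
    (Finset.univ.filter fun σ : Equiv.Perm (Fin n) => desSet σ⁻¹ ⊆ D ∧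
        lec (wordOf σ) = e ∧ pix (wordOf σ) = f).card =
      (Finset.univ.filter fun σ : Equiv.Perm (Fin n) => desSet σ⁻¹ ⊆ D ∧
        excCount σ⁻¹ = e ∧ fixCount σ = f).card := by
  have h := isPrependInsert_hookPrefix.card_filter_eq isPrependInsert_ctxFilter
    (blockContent n D) e f
  rw [← card_filter_desSet_inv_subset, ← card_filter_desSet_inv_subset] at h
  convert h using 2
  · refine Finset.filter_congr fun σ _ => and_congr_right fun hσ => ?_
    rw [hookPrefix_map (wordOf_pairwise hσ), lec_eq_hookPrefix, pix_eq_hookPrefix,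
      Multiset.coe_card, List.length_map]
  · refine Finset.filter_congr fun σ _ => and_congr_right fun hσ => ?_
    have hmap : ∀ o, (ctxFilter o [] ((wordOf σ).map fun x => (D.filter (· < x)).card) []).card =
        (ctxFilter o [] (wordOf σ) []).card := by
      intro o
      have := ctxFilter_map o (L := []) (by simp) (wordOf_pairwise hσ)
      rw [List.map_nil] at this
      rw [this, Multiset.card_map]
    rw [hmap, hmap, card_ctxFilter_gt_wordOf, card_ctxFilter_eq_wordOf]

end Permutations

theorem card_filter_eq_of_card_filter_subset {α : Type*} [Fintype α] (d : α → Finset ℕ)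
    (P Q : α → Prop) [DecidablePred P] [DecidablePred Q]
    (h : ∀ D, (Finset.univ.filter fun a => d a ⊆ D ∧ P a).card =
      (Finset.univ.filter fun a => d a ⊆ D ∧ Q a).card) (D : Finset ℕ) :
    (Finset.univ.filter fun a => d a = D ∧ P a).card =
      (Finset.univ.filter fun a => d a = D ∧ Q a).card := by
  induction D using Finset.strongInduction with
  | H D ih =>
  have key : ∀ (P : α → Prop) [DecidablePred P],
      (Finset.univ.filter fun a => d a ⊆ D ∧ P a).card =
        (Finset.univ.filter fun a => d a = D ∧ P a).card +
          ∑ E ∈ D.ssubsets, (Finset.univ.filter fun a => d a = E ∧ P a).card := by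
    intro P _
    rw [Finset.ssubsets, Finset.add_sum_erase _
        (fun E => (Finset.univ.filter fun a => d a = E ∧ P a).card) (Finset.mem_powerset_self D),
      Finset.card_eq_sum_card_fiberwise (f := d) (t := D.powerset)]
    · refine Finset.sum_congr rfl fun E hE => ?_
      rw [Finset.filter_filter]
      congr 1
      refine Finset.filter_congr fun a _ => ?_
      rw [Finset.mem_powerset] at hE
      constructor
      · rintro ⟨⟨-, hP⟩, rfl⟩
        exact ⟨rfl, hP⟩
      · rintro ⟨rfl, hP⟩
        exact ⟨⟨hE, hP⟩, rfl⟩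
    · intro a ha
      simpa using (Finset.mem_filter.1 ha).2.1
  have hsum := h D
  rw [key P, key Q, Finset.sum_congr rfl fun E hE => ih E (Finset.mem_ssubsets.1 hE)] at hsum
  exact add_right_cancel hsum

theorem exists_equiv_of_card_fiber_eq {α β : Type*} [Fintype α] [DecidableEq β] (f g : α → β)
    (h : ∀ b, (Finset.univ.filter fun a => f a = b).card =
      (Finset.univ.filter fun a => g a = b).card) :
    ∃ e : α ≃ α, ∀ a, f (e a) = g a := by
  have hfib : ∀ b, Nonempty ({a // g a = b} ≃ {a // f a = b}) := by
    intro b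
    rw [← Fintype.card_eq, Fintype.card_subtype, Fintype.card_subtype, h]
  refine ⟨(Equiv.sigmaFiberEquiv g).symm.trans ((Equiv.sigmaCongrRight fun b => (hfib b).some).trans
    (Equiv.sigmaFiberEquiv f)), fun a => ?_⟩
  exact ((hfib (g a)).some ⟨a, rfl⟩).2

/-- There is a bijection `Ψ` of `S_n` onto itself such that
`lec Ψ(σ) = exc σ⁻¹`, `pix Ψ(σ) = fix σ` and `IDES Ψ(σ) = IDES σ` (with
`IDES σ = DES σ⁻¹`, and `lec`, `pix` computed on the word `σ₁σ₂…σ_n`); in particular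
`(iexc, fix, IDES)` and `(lec, pix, IDES)` are equidistributed on `S_n`. -/
theorem exists_bijection_lec_pix_IDES (n : ℕ) (hn : 0 < n) :
    ∃ Ψ : Equiv.Perm (Fin n) ≃ Equiv.Perm (Fin n),
      ∀ σ : Equiv.Perm (Fin n),
        lec (wordOf (Ψ σ)) = excCount σ⁻¹ ∧
          pix (wordOf (Ψ σ)) = fixCount σ ∧
          desSet (Ψ σ)⁻¹ = desSet σ⁻¹ := by
  obtain ⟨Ψ, hΨ⟩ := exists_equiv_of_card_fiber_eq
    (fun σ : Equiv.Perm (Fin n) => (desSet σ⁻¹, lec (wordOf σ), pix (wordOf σ)))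
    (fun σ => (desSet σ⁻¹, excCount σ⁻¹, fixCount σ)) (by
      rintro ⟨D, e, f⟩
      simp only [Prod.mk.injEq]
      exact card_filter_eq_of_card_filter_subset (fun σ : Equiv.Perm (Fin n) => desSet σ⁻¹) _ _
        (fun D => card_filter_lec_pix_eq D e f) D)
  refine ⟨Ψ, fun σ => ?_⟩
  have h := hΨ σ
  simp only [Prod.mk.injEq] at h
  exact ⟨h.2.1, h.2.2, h.1⟩
end
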